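/- arXiv:0810.5551 — 9 statements merged into one kernel-verified Lean document; each statement's English description precedes it below -/
import Mathlib

section
/- Consider sampling without replacement from a population of N units of which M have a certain attribute, so that the indicator variables X_1, …, X_N have the joint distribution Pr{X_i = x_i, i = 1,…,n} = C(M, Σx_i)·C(N−M, n−Σx_i) / (C(n, Σx_i)·C(N, n)) for every n ≤ N and x_i ∈ {0,1}, and let p = M/N. Let γ, n be positive integers with n ≤ N, and let p̂ = 𝐤/𝐧 be the estimator of the truncated inverse sampling scheme applied to X_1, …, X_N. Let 0 < δ < 1 and 0 < ε_a < ε_r < 1 satisfy ε_a/ε_r + ε_a ≤ 1/2, and set p⋆ = ε_a/ε_r. If n > ln(δ/2)/𝓜_B(p⋆ + ε_a, p⋆) and γ > ln(δ/2)/𝓜_I(p⋆ + ε_a, p⋆), then Pr{ |p̂ − p| < ε_a or |p̂ − p| < p·ε_r } > 1 − δ. -/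
open MeasureTheory ProbabilityTheory

/-- `𝓜_B(z, μ) = z ln(μ/z) + (1-z) ln((1-μ)/(1-z))`. -/
noncomputable def McalB (z μ : ℝ) : ℝ :=
  z * Real.log (μ / z) + (1 - z) * Real.log ((1 - μ) / (1 - z))

/-- `𝓜_I(z, μ) = 𝓜_B(z, μ) / z`. -/
noncomputable def McalI (z μ : ℝ) : ℝ := McalB z μ / z

/-- Stopping time `𝐧` of the truncated inverse sampling scheme. -/
noncomputable def stopTime {Ω : Type*} (X : ℕ → Ω → ℝ) (γ : ℝ) (n : ℕ) (ω : Ω) : ℕ :=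
  sInf (insert n {ℓ : ℕ | 0 < ℓ ∧ γ ≤ ∑ i ∈ Finset.range ℓ, X i ω})

/-- Sample sum `𝐤` of the truncated inverse sampling scheme. -/
noncomputable def sampleSum {Ω : Type*} (X : ℕ → Ω → ℝ) (γ : ℝ) (n : ℕ) (ω : Ω) : ℝ :=
  ∑ i ∈ Finset.range (stopTime X γ n ω), X i ω

/-- Estimator `p̂ = 𝐤 / 𝐧` of the truncated inverse sampling scheme. -/
noncomputable def estimator {Ω : Type*} (X : ℕ → Ω → ℝ) (γ : ℝ) (n : ℕ) (ω : Ω) : ℝ :=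
  min (sampleSum X γ n ω) γ / (stopTime X γ n ω : ℝ)

lemma tis_choose_pow (M N : ℕ) (h : M ≤ N) (j : ℕ) :
    M.choose j * N ^ j ≤ N.choose j * M ^ j := by
  have key : M.descFactorial j * N ^ j ≤ N.descFactorial j * M ^ j := by
    induction j with
    | zero => simp
    | succ j ih =>
      rw [Nat.descFactorial_succ, Nat.descFactorial_succ, pow_succ, pow_succ]
      have h2 : (M - j) * N ≤ (N - j) * M := by
        rw [Nat.sub_mul, Nat.sub_mul, mul_comm M N]
        exact Nat.sub_le_sub_left (Nat.mul_le_mul_left _ h) _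
      calc (M - j) * M.descFactorial j * (N ^ j * N)
          = (M.descFactorial j * N ^ j) * ((M - j) * N) := by ring
        _ ≤ (N.descFactorial j * M ^ j) * ((N - j) * M) := Nat.mul_le_mul ih h2
        _ = _ := by ring
  rw [Nat.descFactorial_eq_factorial_mul_choose, Nat.descFactorial_eq_factorial_mul_choose,
    mul_assoc, mul_assoc] at key
  exact Nat.le_of_mul_le_mul_left key (Nat.factorial_pos j)

/-- Vandermonde with a shift. -/
lemma tis_vand (M L m j : ℕ) (hj : j ≤ m) :
    ∑ k ∈ Finset.range (m + 1), M.choose k * L.choose (m - k) * k.choose j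
      = M.choose j * (M + L - j).choose (m - j) := by
  rcases Nat.lt_or_ge M j with hM | hM
  · rw [Nat.choose_eq_zero_of_lt hM, zero_mul]
    apply Finset.sum_eq_zero
    intro k _
    rcases Nat.lt_or_ge M k with h | h
    · rw [Nat.choose_eq_zero_of_lt h]; simp
    · rw [Nat.choose_eq_zero_of_lt (lt_of_le_of_lt h hM)]; simp
  · have e : M + L - j = (M - j) + L := by omega
    rw [e, Nat.add_choose_eq, Finset.Nat.sum_antidiagonal_eq_sum_range_succ_mk, Finset.mul_sum]
    have e2 : m + 1 = j + (m - j + 1) := by omega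
    rw [e2, Finset.sum_range_add]
    have z : ∑ k ∈ Finset.range j, M.choose k * L.choose (j + (m - j + 1) - 1 - k) * k.choose j = 0 := by
      apply Finset.sum_eq_zero
      intro k hk
      rw [Nat.choose_eq_zero_of_lt (Finset.mem_range.1 hk)]; simp
    have z' : ∑ k ∈ Finset.range j, M.choose k * L.choose (m - k) * k.choose j = 0 := by
      apply Finset.sum_eq_zero
      intro k hk
      rw [Nat.choose_eq_zero_of_lt (Finset.mem_range.1 hk)]; simp
    rw [z', zero_add]
    apply Finset.sum_congr rfl
    intro i hi
    have h1 : m - (j + i) = m - j - i := by omega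
    rw [h1]
    rcases Nat.lt_or_ge M (j + i) with h | h
    · rw [Nat.choose_eq_zero_of_lt h, Nat.choose_eq_zero_of_lt (show M - j < i by omega)]; simp
    · have := Nat.choose_mul (n := M) (k := j + i) (s := j) (by omega)
      simp only [Nat.add_sub_cancel_left] at this
      calc _ = (M.choose (j+i) * (j+i).choose j) * L.choose (m - j - i) := by ring
        _ = _ := by rw [this]; ring

lemma tis_mgf_upper (M L m : ℕ) (hN : 0 < M + L) (c : ℝ) (hc : 0 ≤ c) :
    ∑ k ∈ Finset.range (m + 1), ((M.choose k * L.choose (m - k) : ℕ) : ℝ) * (1 + c) ^ k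
      ≤ (M + L).choose m * (1 + (M : ℝ) / (M + L : ℕ) * c) ^ m := by
  have hN' : (0 : ℝ) < ((M + L : ℕ) : ℝ) := by exact_mod_cast hN
  have e1 : ∀ k ∈ Finset.range (m + 1),
      ((M.choose k * L.choose (m - k) : ℕ) : ℝ) * (1 + c) ^ k
      = ∑ j ∈ Finset.range (m + 1),
        ((M.choose k * L.choose (m - k) * k.choose j : ℕ) : ℝ) * c ^ j := by
    intro k hk
    rw [add_comm, add_pow, Finset.mul_sum]
    have hk' := Finset.mem_range.1 hk
    rw [← Finset.sum_subset (Finset.range_mono (show k + 1 ≤ m + 1 by omega))]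
    · apply Finset.sum_congr rfl
      intro j _
      push_cast; ring
    · intro j _ hj
      rw [Nat.choose_eq_zero_of_lt (show k < j by simpa using hj)]; simp
  rw [Finset.sum_congr rfl e1, Finset.sum_comm, add_comm (1:ℝ), add_pow, Finset.mul_sum]
  apply Finset.sum_le_sum
  intro j hj
  have hj' : j ≤ m := by have := Finset.mem_range.1 hj; omega
  rw [← Finset.sum_mul, ← Nat.cast_sum, tis_vand M L m j hj']
  have h1 : M.choose j * (M + L - j).choose (m - j) * (M + L) ^ j
      ≤ (M + L).choose m * m.choose j * M ^ j := by
    rw [Nat.choose_mul hj']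
    calc _ = (M.choose j * (M + L) ^ j) * (M + L - j).choose (m - j) := by ring
      _ ≤ ((M + L).choose j * M ^ j) * (M + L - j).choose (m - j) :=
        Nat.mul_le_mul_right _ (tis_choose_pow M (M + L) (by omega) j)
      _ = _ := by ring
  have h2 : ((M.choose j * (M + L - j).choose (m - j) : ℕ) : ℝ) 
      ≤ (M + L).choose m * m.choose j * ((M : ℝ) / (M + L : ℕ)) ^ j := by
    rw [div_pow, ← mul_div_assoc, le_div_iff₀ (by positivity)]
    exact_mod_cast h1
  calc _ ≤ (M + L).choose m * m.choose j * ((M : ℝ) / (M + L : ℕ)) ^ j * c ^ j :=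
        mul_le_mul_of_nonneg_right h2 (by positivity)
    _ = _ := by rw [mul_pow]; simp; ring

/-- MGF bound for the hypergeometric law, for all `x > 0`. -/
lemma tis_mgf (M N m : ℕ) (hMN : M ≤ N) (hN : 0 < N) (x : ℝ) (hx : 0 < x) :
    ∑ k ∈ Finset.range (m + 1), ((M.choose k * (N - M).choose (m - k) : ℕ) : ℝ) * x ^ k
      ≤ N.choose m * (1 - (M : ℝ) / N + (M : ℝ) / N * x) ^ m := by
  obtain ⟨L, rfl⟩ := Nat.exists_eq_add_of_le hMN
  rw [Nat.add_sub_cancel_left]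
  have hN' : (0 : ℝ) < ((M + L : ℕ) : ℝ) := by exact_mod_cast hN
  rcases le_total 1 x with h | h
  · have := tis_mgf_upper M L m hN (x - 1) (by linarith)
    convert this using 3
    · ring
    · ring
  · have h1 : 1 ≤ x⁻¹ := (one_le_inv₀ hx).2 h
    have := tis_mgf_upper L M m (by omega) (x⁻¹ - 1) (by linarith)
    have h3 := mul_le_mul_of_nonneg_left this (pow_pos hx m).le
    rw [← Finset.sum_range_reflect, Finset.mul_sum] at h3
    have hr : x ^ m * (((L + M).choose m : ℝ) * (1 + (L : ℝ) / (L + M : ℕ) * (x⁻¹ - 1)) ^ m)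
      = ((M + L).choose m : ℝ) * (1 - (M : ℝ) / (M + L : ℕ) + (M : ℝ) / (M + L : ℕ) * x) ^ m := by
      rw [add_comm L M, mul_left_comm, ← mul_pow]
      congr 2
      have : (L : ℝ) = ((M + L : ℕ) : ℝ) - M := by push_cast; ring
      rw [this]
      field_simp
      ring
    rw [hr] at h3
    refine le_trans (le_of_eq ?_) h3
    apply Finset.sum_congr rfl
    intro k hk
    have hk' : k ≤ m := by have := Finset.mem_range.1 hk; omega
    have e1 : m + 1 - 1 - k = m - k := by omega
    have e2 : m - (m - k) = k := by omega
    rw [e1, e2]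
    have e3 : x ^ m * (1 + (x⁻¹ - 1)) ^ (m - k) = x ^ k := by
      rw [add_sub_cancel, inv_pow, ← div_eq_mul_inv, div_eq_iff (by positivity), ← pow_add]
      congr 1; omega
    rw [mul_left_comm, e3, mul_comm (L.choose _)]
lemma tis_bern (q p c : ℝ) (hq : 0 < q) (hqp : q ≤ p) (hc : 0 < 1 + p * c) :
    Real.log (1 + p * c) ≤ p / q * Real.log (1 + q * c) := by
  have hp : 0 < p := by linarith
  have h := rpow_one_add_le_one_add_mul_self (s := p * c) (by linarith) (p := q / p)
    (by positivity) ((div_le_one hp).2 hqp)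
  have e : 1 + q / p * (p * c) = 1 + q * c := by field_simp
  rw [e] at h
  have h2 := Real.log_le_log (Real.rpow_pos_of_pos hc _) h
  rw [Real.log_rpow hc] at h2
  have h3 := mul_le_mul_of_nonneg_left h2 (show 0 ≤ p / q by positivity)
  have e2 : p / q * (q / p * Real.log (1 + p * c)) = Real.log (1 + p * c) := by field_simp
  linarith

lemma tis_sym (p x : ℝ) (hp0 : 0 ≤ p) (hp : p ≤ 1 / 2) (hx : 1 ≤ x) :
    Real.log (1 + p * (x⁻¹ - 1)) + 2 * p * Real.log x ≤ Real.log (1 + p * (x - 1)) := by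
  have hpos : ∀ y : ℝ, 0 < y → 0 < 1 + p * (y - 1) := by intro y hy; nlinarith
  let f : ℝ → ℝ := fun y => Real.log (1 + p * (y - 1)) - Real.log (1 + p * (y⁻¹ - 1)) 
    - 2 * p * Real.log y
  have hd : ∀ y : ℝ, 0 < y → HasDerivAt f
      (p / (1 + p * (y - 1)) - (p * (-(y ^ 2)⁻¹)) / (1 + p * (y⁻¹ - 1)) - 2 * p * y⁻¹) y := by
    intro y hy
    have d1 : HasDerivAt (fun y : ℝ => 1 + p * (y - 1)) p y := by
      simpa using (((hasDerivAt_id y).sub_const 1).const_mul p).const_add 1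
    have d2 : HasDerivAt (fun y : ℝ => 1 + p * (y⁻¹ - 1)) (p * (-(y ^ 2)⁻¹)) y := 
      (((hasDerivAt_inv hy.ne').sub_const 1).const_mul p).const_add 1
    exact ((d1.log (hpos y hy).ne').sub (d2.log (hpos _ (inv_pos.2 hy)).ne')).sub
      ((Real.hasDerivAt_log hy.ne').const_mul (2 * p))
  have hm : MonotoneOn f (Set.Ici 1) := by
    apply monotoneOn_of_deriv_nonneg (convex_Ici 1)
    · intro y hy
      exact (hd y (lt_of_lt_of_le one_pos hy)).continuousAt.continuousWithinAt
    · intro y hy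
      rw [interior_Ici] at hy
      exact (hd y (lt_trans one_pos hy)).differentiableAt.differentiableWithinAt
    · intro y hy
      rw [interior_Ici] at hy
      have hy1 : 1 < y := hy
      have hy0 : 0 < y := by linarith
      rw [(hd y hy0).deriv]
      have a := hpos y hy0
      have b' : 0 < y + p * (1 - y) := by nlinarith
      have b : (1 + p * (y⁻¹ - 1)) = (y + p * (1 - y)) / y := by field_simp
      rw [b]
      have : p / (1 + p * (y - 1)) - (p * (-(y ^ 2)⁻¹)) / ((y + p * (1 - y)) / y) - 2 * p * y⁻¹
        = p * (1 - p) * (1 - 2 * p) * (y - 1) ^ 2 / ((1 + p * (y - 1)) * (y + p * (1 - y)) * y) := by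
        field_simp
        ring
      rw [this]
      have : 0 ≤ 1 - p := by linarith
      have : 0 ≤ 1 - 2 * p := by linarith
      positivity
  have := hm (Set.mem_Ici.2 le_rfl) (Set.mem_Ici.2 hx) hx
  simp only [f] at this
  simp at this
  linarith

/-- analytic core -/
lemma tis_analytic (q r : ℝ) (hq : 0 < q) (hr : 0 < r) (hz : q + q * r ≤ 1 / 2) :
    0 < -McalB (q + q * r) q ∧ ∃ x : ℝ, 1 < x ∧
    (∀ p, 0 ≤ p → p ≤ q →
      -McalB (q + q * r) q ≤ (p + q * r) * Real.log x - Real.log (1 - p + p * x)) ∧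
    (∀ p, 0 ≤ p → p ≤ q →
      -McalB (q + q * r) q ≤ (p - q * r) * Real.log x⁻¹ - Real.log (1 - p + p * x⁻¹)) ∧
    (∀ p, q ≤ p → p ≤ 1 →
      p / q * -McalB (q + q * r) q ≤ (p + p * r) * Real.log x - Real.log (1 - p + p * x)) ∧
    (∀ p, q ≤ p → p ≤ 1 →
      p / q * -McalB (q + q * r) q ≤ (p - p * r) * Real.log x⁻¹ - Real.log (1 - p + p * x⁻¹)) := by
  have hqr : 0 < q * r := by positivity
  set z := q + q * r with hzdef
  have hz0 : 0 < z := by linarith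
  have hz1 : 0 < 1 - z := by linarith
  have hq1 : 0 < 1 - q := by linarith
  have hD : 0 < -McalB z q := by
    unfold McalB
    have h1 : Real.log (q / z) < q / z - 1 :=
      Real.log_lt_sub_one_of_pos (by positivity) (by
        intro h; rw [div_eq_one_iff_eq hz0.ne'] at h; linarith)
    have h2 : Real.log ((1 - q) / (1 - z)) ≤ (1 - q) / (1 - z) - 1 :=
      Real.log_le_sub_one_of_pos (by positivity)
    have h1' := mul_lt_mul_of_pos_left h1 hz0
    have h2' := mul_le_mul_of_nonneg_left h2 hz1.le
    have e1 : z * (q / z - 1) = q - z := by field_simp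
    have e2 : (1 - z) * ((1 - q) / (1 - z) - 1) = z - q := by field_simp; ring
    linarith
  set D := -McalB z q with hDdef
  refine ⟨hD, z * (1 - q) / (q * (1 - z)), ?_⟩
  set x := z * (1 - q) / (q * (1 - z)) with hxdef
  have hx1 : 1 < x := by
    rw [hxdef, one_lt_div (by positivity)]; nlinarith
  have hx0 : 0 < x := by linarith
  have hBq : 1 + q * (x - 1) = (1 - q) / (1 - z) := by
    rw [hxdef]; field_simp; ring
  have hDx : D = z * Real.log x - Real.log (1 + q * (x - 1)) := by
    rw [hBq, hDdef, hxdef, McalB, Real.log_div (by positivity) (by positivity),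
      Real.log_div (by positivity) (by positivity), Real.log_div (by positivity) (by positivity),
      Real.log_mul (by positivity) (by positivity), Real.log_mul (by positivity) (by positivity)]
    ring
  have hB : ∀ p y : ℝ, 1 - p + p * y = 1 + p * (y - 1) := by intros; ring
  simp only [hB]
  have hBpos : ∀ p y : ℝ, 0 ≤ p → p ≤ 1 → 0 < y → 0 < 1 + p * (y - 1) := by
    intro p y h0 h1 hy
    rcases h1.lt_or_eq with h | h
    · nlinarith [mul_nonneg h0 hy.le]
    · subst h; linarith
  have hlog : Real.log x ≤ (x - 1) / (1 + q * (x - 1)) := by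
    have hs : Real.log x ≤ (x - x⁻¹) / 2 := by
      have := Real.self_le_sinh_iff.2 (Real.log_pos hx1).le
      rwa [Real.sinh_log hx0] at this
    refine hs.trans ?_
    rw [le_div_iff₀ (hBpos q x hq.le (by linarith) hx0)]
    have hqx : q * (1 + x) ≤ 1 := by
      have : 1 + x = (q + z - 2 * q * z) / (q * (1 - z)) := by rw [hxdef]; field_simp; ring
      rw [this, ← mul_div_assoc, div_le_one (by positivity)]
      nlinarith [mul_nonneg hq.le (mul_nonneg hq1.le (show 0 ≤ 1 - 2 * z by linarith))]
    have e : x - x⁻¹ = (x - 1) * ((1 + x) / x) := by field_simp; ring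
    rw [e]
    have : (1 + x) / x / 2 * (1 + q * (x - 1)) ≤ 1 := by
      rw [div_div, div_mul_eq_mul_div, div_le_one (by positivity)]
      nlinarith
    calc _ = (x - 1) * ((1 + x) / x / 2 * (1 + q * (x - 1))) := by ring
      _ ≤ (x - 1) * 1 := mul_le_mul_of_nonneg_left this (by linarith)
      _ = _ := by ring
  have hup : ∀ p, 0 ≤ p → p ≤ q →
      D ≤ (p + q * r) * Real.log x - Real.log (1 + p * (x - 1)) := by
    intro p hp0 hpq
    have b1 := hBpos p x hp0 (by linarith) hx0
    have b2 := hBpos q x hq.le (by linarith) hx0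
    have h1 := Real.log_le_sub_one_of_pos (div_pos b1 b2)
    rw [Real.log_div b1.ne' b2.ne'] at h1
    have e : (1 + p * (x - 1)) / (1 + q * (x - 1)) - 1
      = - ((q - p) * ((x - 1) / (1 + q * (x - 1)))) := by
      rw [div_sub_one b2.ne', ← mul_div_assoc, ← neg_div]; congr 1; ring
    have h2 := mul_le_mul_of_nonneg_left hlog (show 0 ≤ q - p by linarith)
    rw [hDx, hzdef]
    linarith
  have hlow : ∀ p, 0 ≤ p → p ≤ q →
      D ≤ (p - q * r) * Real.log x⁻¹ - Real.log (1 + p * (x⁻¹ - 1)) := by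
    intro p hp0 hpq
    have := hup p hp0 hpq
    have h2 := tis_sym p x hp0 (by linarith) hx1.le
    rw [Real.log_inv]
    linarith
  refine ⟨hx1, hup, hlow, ?_, ?_⟩
  · intro p hqp hp1
    have h1 := tis_bern q p (x - 1) hq hqp (hBpos p x (by linarith) hp1 hx0)
    have h2 := mul_le_mul_of_nonneg_left (hup q hq.le le_rfl) (show 0 ≤ p / q from div_nonneg (by linarith) hq.le)
    have e : p / q * ((q + q * r) * Real.log x - Real.log (1 + q * (x - 1)))
      = (p + p * r) * Real.log x - p / q * Real.log (1 + q * (x - 1)) := by field_simp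
    linarith
  · intro p hqp hp1
    have h1 := tis_bern q p (x⁻¹ - 1) hq hqp (hBpos p x⁻¹ (by linarith) hp1 (by positivity))
    have h2 := mul_le_mul_of_nonneg_left (hlow q hq.le le_rfl) (show 0 ≤ p / q from div_nonneg (by linarith) hq.le)
    have e : p / q * ((q - q * r) * Real.log x⁻¹ - Real.log (1 + q * (x⁻¹ - 1)))
      = (p - p * r) * Real.log x⁻¹ - p / q * Real.log (1 + q * (x⁻¹ - 1)) := by field_simp
    linarith
lemma tis_sum_card {Ω : Type*} (X : ℕ → Ω → ℝ) (h01 : ∀ i ω, X i ω = 0 ∨ X i ω = 1)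
    (m : ℕ) (ω : Ω) :
    ∑ i ∈ Finset.range m, X i ω = (((Finset.range m).filter (fun i => X i ω = 1)).card : ℝ) := by
  rw [Finset.card_filter]
  push_cast
  apply Finset.sum_congr rfl
  intro i _
  rcases h01 i ω with h | h <;> simp [h]

lemma tis_prob {Ω : Type*} [MeasurableSpace Ω] (P : Measure Ω)
    (N M : ℕ) (X : ℕ → Ω → ℝ) (h01 : ∀ i ω, X i ω = 0 ∨ X i ω = 1)
    (hjoint : ∀ m : ℕ, m ≤ N → ∀ x : ℕ → ℕ, (∀ i, x i ≤ 1) →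
      P {ω | ∀ i < m, X i ω = (x i : ℝ)}
        = ENNReal.ofReal
            (((M.choose (∑ i ∈ Finset.range m, x i)
                * (N - M).choose (m - ∑ i ∈ Finset.range m, x i) : ℕ) : ℝ)
              / ((m.choose (∑ i ∈ Finset.range m, x i) * N.choose m : ℕ) : ℝ)))
    (m : ℕ) (hm : m ≤ N) (f : ℝ → ℝ) (hf0 : ∀ k, 0 ≤ f k) :
    P {ω | 1 ≤ f (∑ i ∈ Finset.range m, X i ω)} ≤ ENNReal.ofReal
      (∑ k ∈ Finset.range (m + 1),
        ((M.choose k * (N - M).choose (m - k) : ℕ) : ℝ) / (N.choose m : ℝ) * f k) := by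
  classical
  let w : ℕ → ℝ := fun k => ((M.choose k * (N - M).choose (m - k) : ℕ) : ℝ)
              / ((m.choose k * N.choose m : ℕ) : ℝ)
  have hw : ∀ k, 0 ≤ w k := fun k => by positivity
  let I : Finset (Finset ℕ) := (Finset.range m).powerset.filter (fun A => 1 ≤ f A.card)
  have hsub : {ω | 1 ≤ f (∑ i ∈ Finset.range m, X i ω)} ⊆
      ⋃ A ∈ I, {ω | ∀ i < m, X i ω = ((if i ∈ A then 1 else 0 : ℕ) : ℝ)} := by
    intro ω hω
    simp only [Set.mem_ofPred_eq] at hω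
    rw [tis_sum_card X h01] at hω
    refine Set.mem_biUnion (x := (Finset.range m).filter (fun i => X i ω = 1)) ?_ ?_
    · simp only [I, Finset.coe_filter, Set.mem_ofPred_eq, Finset.mem_powerset]
      exact ⟨Finset.filter_subset _ _, hω⟩
    · intro i hi
      rcases h01 i ω with h | h <;> simp [h, hi]
  have hA : ∀ A ∈ I, P {ω | ∀ i < m, X i ω = ((if i ∈ A then 1 else 0 : ℕ) : ℝ)}
      = ENNReal.ofReal (w A.card) := by
    intro A hA
    simp only [I, Finset.mem_filter, Finset.mem_powerset] at hA
    have := hjoint m hm (fun i => if i ∈ A then 1 else 0) (by intro i; split_ifs <;> simp)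
    have hs : ∑ i ∈ Finset.range m, (if i ∈ A then 1 else 0) = A.card := by
      rw [← Finset.card_filter, Finset.filter_mem_eq_inter, Finset.inter_eq_right.2 hA.1]
    rw [hs] at this
    exact this
  calc _ ≤ P (⋃ A ∈ I, {ω | ∀ i < m, X i ω = ((if i ∈ A then 1 else 0 : ℕ) : ℝ)}) :=
        measure_mono hsub
    _ ≤ ∑ A ∈ I, P {ω | ∀ i < m, X i ω = ((if i ∈ A then 1 else 0 : ℕ) : ℝ)} :=
        measure_biUnion_finset_le _ _
    _ = ∑ A ∈ I, ENNReal.ofReal (w A.card) := Finset.sum_congr rfl hA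
    _ = ENNReal.ofReal (∑ A ∈ I, w A.card) := (ENNReal.ofReal_sum_of_nonneg (fun _ _ => hw _)).symm
    _ ≤ _ := by
      apply ENNReal.ofReal_le_ofReal
      calc ∑ A ∈ I, w A.card ≤ ∑ A ∈ I, w A.card * f A.card := by
            apply Finset.sum_le_sum
            intro A hA
            exact le_mul_of_one_le_right (hw _) (Finset.mem_filter.1 hA).2
        _ ≤ ∑ A ∈ (Finset.range m).powerset, w A.card * f A.card :=
            Finset.sum_le_sum_of_subset_of_nonneg (Finset.filter_subset _ _)
              (fun _ _ _ => mul_nonneg (hw _) (hf0 _))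
        _ = ∑ k ∈ Finset.range (m + 1), m.choose k • (w k * f k) := by
            rw [Finset.sum_powerset_apply_card (fun k => w k * f k), Finset.card_range]
        _ = _ := by
            apply Finset.sum_congr rfl
            intro k hk
            have hk' : k ≤ m := by have := Finset.mem_range.1 hk; omega
            have h1 : (0 : ℝ) < m.choose k := by exact_mod_cast Nat.choose_pos hk'
            have h2 : (0 : ℝ) < N.choose m := by exact_mod_cast Nat.choose_pos hm
            simp only [w, nsmul_eq_mul]
            push_cast
            field_simp

lemma tis_chernoff {Ω : Type*} [MeasurableSpace Ω] (P : Measure Ω)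
    (N M : ℕ) (hMN : M ≤ N) (hN : 0 < N)
    (X : ℕ → Ω → ℝ) (h01 : ∀ i ω, X i ω = 0 ∨ X i ω = 1)
    (hjoint : ∀ m : ℕ, m ≤ N → ∀ x : ℕ → ℕ, (∀ i, x i ≤ 1) →
      P {ω | ∀ i < m, X i ω = (x i : ℝ)}
        = ENNReal.ofReal
            (((M.choose (∑ i ∈ Finset.range m, x i)
                * (N - M).choose (m - ∑ i ∈ Finset.range m, x i) : ℕ) : ℝ)
              / ((m.choose (∑ i ∈ Finset.range m, x i) * N.choose m : ℕ) : ℝ)))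
    (m : ℕ) (hm : m ≤ N) (x : ℝ) (hx : 0 < x) (a : ℝ)
    (hB : 0 < 1 - (M : ℝ) / N + (M : ℝ) / N * x) :
    P {ω | a * Real.log x ≤ (∑ i ∈ Finset.range m, X i ω) * Real.log x} ≤ ENNReal.ofReal
      (Real.exp (m * Real.log (1 - (M : ℝ) / N + (M : ℝ) / N * x) - a * Real.log x)) := by
  have h := tis_prob P N M X h01 hjoint m hm (fun s => Real.exp (s * Real.log x - a * Real.log x))
    (fun _ => (Real.exp_pos _).le)
  simp only [Real.one_le_exp_iff, sub_nonneg] at h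
  refine h.trans (ENNReal.ofReal_le_ofReal ?_)
  have h2 : (0 : ℝ) < N.choose m := by exact_mod_cast Nat.choose_pos hm
  have h3 := tis_mgf M N m hMN hN x hx
  rw [Real.exp_sub, mul_comm (m : ℝ), Real.exp_mul, Real.exp_log hB, Real.rpow_natCast,
    le_div_iff₀ (Real.exp_pos _), Finset.sum_mul]
  rw [← div_le_iff₀' h2, Finset.sum_div] at h3
  refine le_trans (le_of_eq ?_) h3
  apply Finset.sum_congr rfl
  intro k _
  have : Real.exp (k * Real.log x - a * Real.log x) * Real.exp (a * Real.log x) = x ^ k := by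
    rw [← Real.exp_add, sub_add_cancel, mul_comm, Real.exp_mul, Real.exp_log hx, Real.rpow_natCast]
  rw [mul_assoc, this]
  ring

section
variable {Ω : Type*} (X : ℕ → Ω → ℝ) (γ n : ℕ) (ω : Ω)

lemma tis_stop_le : stopTime X (γ : ℝ) n ω ≤ n := Nat.sInf_le (Set.mem_insert _ _)

lemma tis_stop_cases (hn : 0 < n) : 0 < stopTime X (γ : ℝ) n ω ∧ (stopTime X (γ : ℝ) n ω = n ∨
    (γ : ℝ) ≤ ∑ i ∈ Finset.range (stopTime X (γ : ℝ) n ω), X i ω) := by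
  have h : stopTime X (γ : ℝ) n ω ∈ _ := Nat.sInf_mem (Set.insert_nonempty n
    {ℓ : ℕ | 0 < ℓ ∧ (γ : ℝ) ≤ ∑ i ∈ Finset.range ℓ, X i ω})
  rcases h with h | h
  · exact ⟨lt_of_lt_of_eq hn h.symm, Or.inl h⟩
  · exact ⟨h.1, Or.inr h.2⟩

lemma tis_stop_lt (ℓ : ℕ) (h0 : 0 < ℓ) (h : ℓ < stopTime X (γ : ℝ) n ω) :
    ∑ i ∈ Finset.range ℓ, X i ω < γ := by
  by_contra hc
  exact Nat.notMem_of_lt_sInf h (Set.mem_insert_of_mem _ ⟨h0, not_lt.1 hc⟩)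

lemma tis_mono (h01 : ∀ i ω, X i ω = 0 ∨ X i ω = 1) {a b : ℕ} (hab : a ≤ b) :
    ∑ i ∈ Finset.range a, X i ω ≤ ∑ i ∈ Finset.range b, X i ω := by
  apply Finset.sum_le_sum_of_subset_of_nonneg (Finset.range_mono hab)
  intro i _ _
  rcases h01 i ω with h | h <;> simp [h]

lemma tis_stop_sum_le (h01 : ∀ i ω, X i ω = 0 ∨ X i ω = 1) (hγ : 0 < γ) :
    ∑ i ∈ Finset.range (stopTime X (γ : ℝ) n ω), X i ω ≤ γ := by
  rcases hτ : stopTime X (γ : ℝ) n ω with _ | t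
  · simp
  · rw [Finset.sum_range_succ]
    have h1 : X t ω ≤ 1 := by rcases h01 t ω with h | h <;> simp [h]
    have h2 : ∑ i ∈ Finset.range t, X i ω + 1 ≤ γ := by
      rcases Nat.eq_zero_or_pos t with h | h
      · subst h; simp; exact_mod_cast hγ
      · have := tis_stop_lt X γ n ω t h (by omega)
        rw [tis_sum_card X h01] at this ⊢
        exact_mod_cast this
    linarith
end

lemma tis_upper_event {Ω : Type*} (X : ℕ → Ω → ℝ) (h01 : ∀ i ω, X i ω = 0 ∨ X i ω = 1)
    (γ n : ℕ) (hn : 0 < n) (z : ℝ) (hz : 0 < z) :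
    ∃ m : ℕ, m ≤ n ∧ ∃ T : ℝ, (T = n ∨ T = γ / z) ∧ m ≤ T ∧
      ∀ ω, z ≤ estimator X (γ : ℝ) n ω → z * T ≤ ∑ i ∈ Finset.range m, X i ω := by
  rcases le_or_gt (z * n) γ with h | h
  · refine ⟨n, le_rfl, n, Or.inl rfl, le_rfl, ?_⟩
    intro ω hω
    obtain ⟨h0, hc⟩ := tis_stop_cases X γ n ω hn
    have hle := tis_stop_le X γ n ω
    rw [estimator, sampleSum, le_div_iff₀ (by exact_mod_cast h0)] at hω
    rcases hc with hc | hc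
    · rw [hc] at hω
      exact hω.trans (min_le_left _ _)
    · exact h.trans (hc.trans (tis_mono X ω h01 hle))
  · have hfl : (⌊(γ : ℝ) / z⌋₊ : ℝ) ≤ γ / z := Nat.floor_le (by positivity)
    refine ⟨⌊(γ : ℝ) / z⌋₊, ?_, γ / z, Or.inr rfl, hfl, ?_⟩
    · have : (γ : ℝ) / z < n := by rw [div_lt_iff₀ hz]; linarith
      exact_mod_cast (hfl.trans this.le)
    intro ω hω
    obtain ⟨h0, hc⟩ := tis_stop_cases X γ n ω hn
    rw [estimator, sampleSum, le_div_iff₀ (by exact_mod_cast h0)] at hω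
    have h1 := hω.trans (min_le_right _ _)
    have h2 : stopTime X (γ : ℝ) n ω ≤ ⌊(γ : ℝ) / z⌋₊ := by
      apply Nat.le_floor
      rw [le_div_iff₀ hz]; linarith
    rw [mul_div_cancel₀ _ hz.ne']
    rcases hc with hc | hc
    · rw [hc] at h1; linarith
    · exact hc.trans (tis_mono X ω h01 h2)

lemma tis_lower_event {Ω : Type*} (X : ℕ → Ω → ℝ) (h01 : ∀ i ω, X i ω = 0 ∨ X i ω = 1)
    (γ n : ℕ) (hγ : 0 < γ) (hn : 0 < n) (z : ℝ) (hz : 0 ≤ z) :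
    ∃ m : ℕ, m ≤ n ∧ ∃ T : ℝ, (T = n ∨ (0 < z ∧ T = γ / z)) ∧ T ≤ m ∧
      ∀ ω, estimator X (γ : ℝ) n ω ≤ z → ∑ i ∈ Finset.range m, X i ω ≤ z * T := by
  have hγ' : (0 : ℝ) < γ := by exact_mod_cast hγ
  rcases lt_or_ge (z * n) γ with h | h
  · refine ⟨n, le_rfl, n, Or.inl rfl, le_rfl, ?_⟩
    intro ω hω
    obtain ⟨h0, hc⟩ := tis_stop_cases X γ n ω hn
    have hle : (stopTime X (γ : ℝ) n ω : ℝ) ≤ n := by exact_mod_cast tis_stop_le X γ n ω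
    rw [estimator, sampleSum, div_le_iff₀ (by exact_mod_cast h0),
      min_eq_left (tis_stop_sum_le X γ n ω h01 hγ)] at hω
    rcases hc with hc | hc
    · rwa [hc] at hω
    · have := mul_le_mul_of_nonneg_left hle hz
      linarith
  · have hz' : 0 < z := by
      rcases hz.lt_or_eq with h' | h'
      · exact h'
      · subst h'; linarith
    have hm : ⌈(γ : ℝ) / z⌉₊ ≤ n := by
      apply Nat.ceil_le.2
      rw [div_le_iff₀ hz']; linarith
    refine ⟨⌈(γ : ℝ) / z⌉₊, hm, γ / z, Or.inr ⟨hz', rfl⟩, Nat.le_ceil _, ?_⟩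
    intro ω hω
    obtain ⟨h0, hc⟩ := tis_stop_cases X γ n ω hn
    rw [estimator, sampleSum, div_le_iff₀ (by exact_mod_cast h0),
      min_eq_left (tis_stop_sum_le X γ n ω h01 hγ)] at hω
    rw [mul_div_cancel₀ _ hz'.ne']
    refine le_trans (tis_mono X ω h01 (b := stopTime X (γ : ℝ) n ω) ?_)
      (tis_stop_sum_le X γ n ω h01 hγ)
    rcases hc with hc | hc
    · rwa [hc]
    · apply Nat.ceil_le.2
      rw [div_le_iff₀ hz']; linarith
lemma tis_exp_lt (δ T V : ℝ) (hδ : 0 < δ) (h : -Real.log (δ / 2) < T * V) :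
    Real.exp (-(T * V)) < δ / 2 := by
  rw [← Real.lt_log_iff_exp_lt (by positivity)]; linarith

lemma tis_upper {Ω : Type*} [MeasurableSpace Ω] (P : Measure Ω)
    (N M : ℕ) (hMN : M ≤ N) (hN : 0 < N)
    (X : ℕ → Ω → ℝ) (h01 : ∀ i ω, X i ω = 0 ∨ X i ω = 1)
    (hjoint : ∀ m : ℕ, m ≤ N → ∀ x : ℕ → ℕ, (∀ i, x i ≤ 1) →
      P {ω | ∀ i < m, X i ω = (x i : ℝ)}
        = ENNReal.ofReal
            (((M.choose (∑ i ∈ Finset.range m, x i)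
                * (N - M).choose (m - ∑ i ∈ Finset.range m, x i) : ℕ) : ℝ)
              / ((m.choose (∑ i ∈ Finset.range m, x i) * N.choose m : ℕ) : ℝ)))
    (γ n : ℕ) (hn : 0 < n) (hnN : n ≤ N) (δ : ℝ) (hδ : 0 < δ)
    (x : ℝ) (hx : 1 < x) (z : ℝ) (hz : 0 < z) (p : ℝ) (hp : p = (M : ℝ) / N) (V : ℝ)
    (hV : V = z * Real.log x - Real.log (1 - p + p * x))
    (h1 : -Real.log (δ / 2) < n * V) (h2 : -Real.log (δ / 2) < γ / z * V) :
    P {ω | z ≤ estimator X (γ : ℝ) n ω} < ENNReal.ofReal (δ / 2) := by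
  have hp0 : 0 ≤ p := by rw [hp]; positivity
  have hB : 1 ≤ 1 - p + p * x := by nlinarith
  obtain ⟨m, hm, T, hT, hmT, hω⟩ := tis_upper_event X h01 γ n hn z hz
  have hch := tis_chernoff P N M hMN hN X h01 hjoint m (hm.trans hnN) x (by linarith) (z * T)
    (by rw [← hp]; linarith)
  rw [← hp] at hch
  have hTV : -Real.log (δ / 2) < T * V := by
    rcases hT with rfl | rfl <;> assumption
  calc _ ≤ P {ω | z * T * Real.log x ≤ (∑ i ∈ Finset.range m, X i ω) * Real.log x} := by
        apply measure_mono
        intro ω h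
        exact mul_le_mul_of_nonneg_right (hω ω h) (Real.log_pos hx).le
    _ ≤ _ := hch
    _ < _ := by
      rw [ENNReal.ofReal_lt_ofReal_iff (by positivity)]
      refine lt_of_le_of_lt (Real.exp_le_exp.2 ?_) (tis_exp_lt δ T V hδ hTV)
      have := mul_le_mul_of_nonneg_right hmT (Real.log_nonneg hB)
      rw [hV]; linarith

lemma tis_lower {Ω : Type*} [MeasurableSpace Ω] (P : Measure Ω)
    (N M : ℕ) (hMN : M ≤ N) (hN : 0 < N)
    (X : ℕ → Ω → ℝ) (h01 : ∀ i ω, X i ω = 0 ∨ X i ω = 1)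
    (hjoint : ∀ m : ℕ, m ≤ N → ∀ x : ℕ → ℕ, (∀ i, x i ≤ 1) →
      P {ω | ∀ i < m, X i ω = (x i : ℝ)}
        = ENNReal.ofReal
            (((M.choose (∑ i ∈ Finset.range m, x i)
                * (N - M).choose (m - ∑ i ∈ Finset.range m, x i) : ℕ) : ℝ)
              / ((m.choose (∑ i ∈ Finset.range m, x i) * N.choose m : ℕ) : ℝ)))
    (γ n : ℕ) (hγ : 0 < γ) (hn : 0 < n) (hnN : n ≤ N) (δ : ℝ) (hδ : 0 < δ)
    (x : ℝ) (hx : 1 < x) (z : ℝ) (p : ℝ) (hp : p = (M : ℝ) / N) (V : ℝ)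
    (hV : V = z * Real.log x⁻¹ - Real.log (1 - p + p * x⁻¹))
    (h1 : -Real.log (δ / 2) < n * V) (h2 : 0 < z → -Real.log (δ / 2) < γ / z * V) :
    P {ω | estimator X (γ : ℝ) n ω ≤ z} < ENNReal.ofReal (δ / 2) := by
  rcases lt_or_ge z 0 with hz | hz
  · have : {ω | estimator X (γ : ℝ) n ω ≤ z} = ∅ := by
      ext ω
      simp only [Set.mem_ofPred_eq, Set.mem_empty_iff_false, iff_false, not_le]
      refine lt_of_lt_of_le hz ?_
      rw [estimator, sampleSum, tis_sum_card X h01]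
      positivity
    rw [this, measure_empty]
    exact ENNReal.ofReal_pos.2 (by positivity)
  have hp0 : 0 ≤ p := by rw [hp]; positivity
  have hp1 : p ≤ 1 := by
    rw [hp, div_le_one (by exact_mod_cast hN)]; exact_mod_cast hMN
  have hy0 : 0 < x⁻¹ := by positivity
  have hy1 : x⁻¹ < 1 := inv_lt_one_of_one_lt₀ hx
  have hB : 1 - p + p * x⁻¹ ≤ 1 := by nlinarith
  have hB0 : 0 < 1 - p + p * x⁻¹ := by
    rcases hp1.lt_or_eq with h | h
    · have : 0 ≤ p * x⁻¹ := by positivity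
      linarith
    · rw [h]; linarith
  obtain ⟨m, hm, T, hT, hmT, hω⟩ := tis_lower_event X h01 γ n hγ hn z hz
  have hch := tis_chernoff P N M hMN hN X h01 hjoint m (hm.trans hnN) x⁻¹ hy0 (z * T)
    (by rw [← hp]; exact hB0)
  rw [← hp] at hch
  have hTV : -Real.log (δ / 2) < T * V := by
    rcases hT with rfl | ⟨hz', rfl⟩
    · exact h1
    · exact h2 hz'
  calc _ ≤ P {ω | z * T * Real.log x⁻¹ ≤ (∑ i ∈ Finset.range m, X i ω) * Real.log x⁻¹} := by
        apply measure_mono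
        intro ω h
        exact mul_le_mul_of_nonpos_right (hω ω h) (Real.log_neg hy0 hy1).le
    _ ≤ _ := hch
    _ < _ := by
      rw [ENNReal.ofReal_lt_ofReal_iff (by positivity)]
      refine lt_of_le_of_lt (Real.exp_le_exp.2 ?_) (tis_exp_lt δ T V hδ hTV)
      have := mul_le_mul_of_nonpos_right hmT (Real.log_nonpos hB0.le hB)
      rw [hV]; linarith

lemma tis_final {Ω : Type*} [MeasurableSpace Ω] (P : Measure Ω) [IsProbabilityMeasure P]
    (Y : Ω → ℝ) (p e δ : ℝ) (G : Set Ω) (hδ : 0 < δ) (hδ1 : δ < 1)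
    (hG : ∀ ω, |Y ω - p| < e → ω ∈ G)
    (h1 : P {ω | p + e ≤ Y ω} < ENNReal.ofReal (δ / 2))
    (h2 : P {ω | Y ω ≤ p - e} < ENNReal.ofReal (δ / 2)) :
    ENNReal.ofReal (1 - δ) < P G := by
  have hu : (Set.univ : Set Ω) ⊆ G ∪ ({ω | p + e ≤ Y ω} ∪ {ω | Y ω ≤ p - e}) := by
    intro ω _
    by_cases h : |Y ω - p| < e
    · exact Or.inl (hG ω h)
    · right
      rw [not_lt, le_abs] at h
      rcases h with h | h
      · left; show p + e ≤ Y ω; linarith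
      · right; show Y ω ≤ p - e; linarith
  have h3 : 1 ≤ P G + (P {ω | p + e ≤ Y ω} + P {ω | Y ω ≤ p - e}) := by
    calc (1 : ENNReal) = P Set.univ := measure_univ.symm
      _ ≤ _ := measure_mono hu
      _ ≤ _ := measure_union_le _ _
      _ ≤ _ := by gcongr; exact measure_union_le _ _
  have h4 : P {ω | p + e ≤ Y ω} + P {ω | Y ω ≤ p - e} < ENNReal.ofReal δ := by
    have := ENNReal.add_lt_add h1 h2
    rwa [← ENNReal.ofReal_add (by positivity) (by positivity), add_halves] at this
  by_contra hc
  rw [not_lt] at hc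
  have h5 : P G + (P {ω | p + e ≤ Y ω} + P {ω | Y ω ≤ p - e})
      < ENNReal.ofReal (1 - δ) + ENNReal.ofReal δ :=
    ENNReal.add_lt_add_of_le_of_lt (ne_top_of_le_ne_top ENNReal.ofReal_ne_top hc) hc h4
  rw [← ENNReal.ofReal_add (by linarith) hδ.le, sub_add_cancel, ENNReal.ofReal_one] at h5
  exact absurd h3 (not_le.2 h5)

theorem truncated_inverse_sampling_finite_population_precision
    {Ω : Type*} [MeasurableSpace Ω] (P : Measure Ω) [IsProbabilityMeasure P]
    (N M : ℕ) (hMN : M ≤ N) (hN : 0 < N)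
    (X : ℕ → Ω → ℝ) (hmeas : ∀ i, Measurable (X i))
    (h01 : ∀ i ω, X i ω = 0 ∨ X i ω = 1)
    (hjoint : ∀ m : ℕ, m ≤ N → ∀ x : ℕ → ℕ, (∀ i, x i ≤ 1) →
      P {ω | ∀ i < m, X i ω = (x i : ℝ)}
        = ENNReal.ofReal
            (((M.choose (∑ i ∈ Finset.range m, x i)
                * (N - M).choose (m - ∑ i ∈ Finset.range m, x i) : ℕ) : ℝ)
              / ((m.choose (∑ i ∈ Finset.range m, x i) * N.choose m : ℕ) : ℝ)))
    (γ n : ℕ) (hγ : 0 < γ) (hn : 0 < n) (hnN : n ≤ N)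
    (δ εa εr : ℝ) (hδ0 : 0 < δ) (hδ1 : δ < 1)
    (hεa0 : 0 < εa) (hεaεr : εa < εr) (hεr1 : εr < 1)
    (hcond : εa / εr + εa ≤ 1 / 2)
    (hcn : (n : ℝ) > Real.log (δ / 2) / McalB (εa / εr + εa) (εa / εr))
    (hcγ : (γ : ℝ) > Real.log (δ / 2) / McalI (εa / εr + εa) (εa / εr)) :
    ENNReal.ofReal (1 - δ)
      < P {ω | |estimator X (γ : ℝ) n ω - (M : ℝ) / N| < εa ∨
               |estimator X (γ : ℝ) n ω - (M : ℝ) / N| < ((M : ℝ) / N) * εr} := by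
  have hεr0 : 0 < εr := by linarith
  obtain ⟨q, hq⟩ : ∃ q, q = εa / εr := ⟨_, rfl⟩
  have hq0 : 0 < q := by rw [hq]; positivity
  have hεa : εa = q * εr := by rw [hq]; field_simp
  rw [← hq] at hcond hcn hcγ
  rw [hεa] at hcond hcn hcγ
  obtain ⟨hD, x, hx, hU1, hL1, hU2, hL2⟩ := tis_analytic q εr hq0 hεr0 hcond
  set z := q + q * εr with hz
  have hz0 : 0 < z := by positivity
  obtain ⟨D, hDdef⟩ : ∃ D, D = -McalB z q := ⟨_, rfl⟩
  have hM : McalB z q = -D := by rw [hDdef]; ring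
  rw [← hDdef] at hD hU1 hL1 hU2 hL2
  have hnD : -Real.log (δ / 2) < n * D := by
    rw [hM, gt_iff_lt, div_neg, ← neg_div, div_lt_iff₀ hD] at hcn
    exact hcn
  have hγD : -Real.log (δ / 2) < γ / z * D := by
    rw [McalI, hM, neg_div, gt_iff_lt, div_neg, ← neg_div, div_lt_iff₀ (by positivity)] at hcγ
    calc _ < _ := hcγ
      _ = _ := by ring
  obtain ⟨p, hp⟩ : ∃ p, p = (M : ℝ) / N := ⟨_, rfl⟩
  have hp0 : 0 ≤ p := by rw [hp]; positivity
  have hp1 : p ≤ 1 := by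
    rw [hp, div_le_one (by exact_mod_cast hN)]; exact_mod_cast hMN
  have hn' : (0 : ℝ) < n := by exact_mod_cast hn
  have hγ' : (0 : ℝ) < γ := by exact_mod_cast hγ
  have hqe : 0 < q * εr := by positivity
  rw [← hp]
  -- it suffices to bound the scaled exponents
  have stepn : ∀ V, D ≤ V → -Real.log (δ / 2) < n * V := fun V hV =>
    hnD.trans_le (mul_le_mul_of_nonneg_left hV hn'.le)
  have stepγ : ∀ V y, 0 < y → D / z ≤ V / y → -Real.log (δ / 2) < γ / y * V := by
    intro V y hy h
    calc _ < _ := hγD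
      _ = γ * (D / z) := by ring
      _ ≤ γ * (V / y) := mul_le_mul_of_nonneg_left h hγ'.le
      _ = _ := by ring
  rcases le_total p q with hpq | hpq
  · refine tis_final P (estimator X (γ : ℝ) n) p εa δ _ hδ0 hδ1 (fun ω h => Or.inl h) ?_ ?_
    · have hV := hU1 p hp0 hpq
      rw [← hεa] at hV
      refine tis_upper P N M hMN hN X h01 hjoint γ n hn hnN δ hδ0 x hx (p + εa) (by linarith)
        p hp _ rfl (stepn _ hV) (stepγ _ _ (by linarith) ?_)
      exact div_le_div₀ (by linarith) hV (by linarith) (by linarith)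
    · have hV := hL1 p hp0 hpq
      rw [← hεa] at hV
      refine tis_lower P N M hMN hN X h01 hjoint γ n hγ hn hnN δ hδ0 x hx (p - εa)
        p hp _ rfl (stepn _ hV) (fun h => stepγ _ _ h ?_)
      exact div_le_div₀ (by linarith) hV h (by linarith)
  · have hp0' : 0 < p := by linarith
    have hpqD : D ≤ p / q * D := le_mul_of_one_le_left hD.le ((one_le_div hq0).2 hpq)
    refine tis_final P (estimator X (γ : ℝ) n) p (p * εr) δ _ hδ0 hδ1 (fun ω h => Or.inr h) ?_ ?_
    · have hV := hU2 p hpq hp1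
      have hy : 0 < p + p * εr := by positivity
      refine tis_upper P N M hMN hN X h01 hjoint γ n hn hnN δ hδ0 x hx (p + p * εr) hy
        p hp _ rfl (stepn _ (hpqD.trans hV)) (stepγ _ _ hy ?_)
      calc D / z = (p / q * D) / (p + p * εr) := by rw [hz]; field_simp
        _ ≤ _ := div_le_div_of_nonneg_right hV hy.le
    · have hV := hL2 p hpq hp1
      refine tis_lower P N M hMN hN X h01 hjoint γ n hγ hn hnN δ hδ0 x hx (p - p * εr)
        p hp _ rfl (stepn _ (hpqD.trans hV)) (fun hy => stepγ _ _ hy ?_)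
      calc D / z = (p / q * D) / (p + p * εr) := by rw [hz]; field_simp
        _ ≤ _ := div_le_div₀ (by linarith) hV hy (by
          have : 0 < p * εr := by positivity
          linarith)
end

section
/- Let 0 < ε < 1. Then the function μ ↦ 𝓜_I(μ + ε·μ, μ) is strictly decreasing on the interval (0, 1/(1+ε)), and the function μ ↦ 𝓜_I(μ − ε·μ, μ) is strictly decreasing on the interval (0, 1). -/
lemma McalI_aux (c b : ℝ) (hc : 0 < c) (hc1 : c ≠ 1) (hb : b ≤ 1) (hcb : c * b ≤ 1) :
    StrictAntiOn (fun μ : ℝ => McalI (c * μ) μ) (Set.Ioo 0 b) := by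
  have key : StrictAntiOn (fun μ : ℝ => Real.log (1 / c) +
      (1 / (c * μ) - 1) * (Real.log (1 - μ) - Real.log (1 - c * μ))) (Set.Ioo 0 b) := by
    have hd : ∀ x ∈ Set.Ioo 0 b, HasDerivAt (fun μ : ℝ => Real.log (1 / c) +
      (1 / (c * μ) - 1) * (Real.log (1 - μ) - Real.log (1 - c * μ)))
      ((-c / (c * x) ^ 2) * (Real.log (1 - x) - Real.log (1 - c * x)) +
        (1 / (c * x) - 1) * (-1 / (1 - x) - -c / (1 - c * x))) x := by
      rintro x ⟨hx0, hxb⟩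
      have h1 : 0 < 1 - x := by linarith
      have h2 : 0 < 1 - c * x := by nlinarith
      have hcx : HasDerivAt (fun μ : ℝ => c * μ) c x := by
        simpa using (hasDerivAt_id x).const_mul c
      have a1 : HasDerivAt (fun μ : ℝ => 1 / (c * μ) - 1) (-c / (c * x) ^ 2) x := by
        simpa [one_div] using (hcx.fun_inv (by positivity)).sub_const 1
      have a2 : HasDerivAt (fun μ : ℝ => Real.log (1 - μ)) (-1 / (1 - x)) x :=
        ((hasDerivAt_id x).const_sub 1).log h1.ne'
      have a3 : HasDerivAt (fun μ : ℝ => Real.log (1 - c * μ)) (-c / (1 - c * x)) x :=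
        (hcx.const_sub 1).log h2.ne'
      exact (a1.mul (a2.sub a3)).const_add _
    apply strictAntiOn_of_deriv_neg (convex_Ioo 0 b)
    · exact fun x hx => (hd x hx).continuousAt.continuousWithinAt
    · intro x hx
      rw [interior_Ioo] at hx
      rw [(hd x hx).deriv]
      obtain ⟨hx0, hxb⟩ := hx
      have h1 : 0 < 1 - x := by linarith
      have h2 : 0 < 1 - c * x := by nlinarith
      have hne : (1 - c * x) / (1 - x) ≠ 1 := by
        intro h
        rw [div_eq_one_iff_eq h1.ne'] at h
        apply hc1
        have : (c - 1) * x = 0 := by linarith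
        rcases mul_eq_zero.1 this with h | h <;> linarith
      have hl := Real.log_lt_sub_one_of_pos (div_pos h2 h1) hne
      rw [Real.log_div h2.ne' h1.ne'] at hl
      have e : (-c / (c * x) ^ 2) * (Real.log (1 - x) - Real.log (1 - c * x)) +
        (1 / (c * x) - 1) * (-1 / (1 - x) - -c / (1 - c * x)) =
        (1 / (c * x ^ 2)) * ((Real.log (1 - c * x) - Real.log (1 - x)) -
          ((1 - c * x) / (1 - x) - 1)) := by
        have := h1.ne'
        have := h2.ne'
        generalize Real.log (1 - c * x) = A
        generalize Real.log (1 - x) = B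
        field_simp
        ring
      rw [e]
      exact mul_neg_of_pos_of_neg (by positivity) (by linarith)
  refine key.congr ?_
  rintro x ⟨hx0, hxb⟩
  have h1 : 0 < 1 - x := by linarith
  have h2 : 0 < 1 - c * x := by nlinarith
  have e : x / (c * x) = 1 / c := by field_simp
  simp only [McalI, McalB]
  rw [e, Real.log_div h1.ne' h2.ne']
  field_simp

theorem McalI_relative_strictAnti (ε : ℝ) (hε0 : 0 < ε) (hε1 : ε < 1) :
    StrictAntiOn (fun μ : ℝ => McalI (μ + ε * μ) μ) (Set.Ioo 0 (1 / (1 + ε))) ∧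
    StrictAntiOn (fun μ : ℝ => McalI (μ - ε * μ) μ) (Set.Ioo 0 1) := by
  constructor
  · have h := McalI_aux (1 + ε) (1 / (1 + ε)) (by linarith) (by linarith)
      (by rw [div_le_one (by linarith)]; linarith)
      (by rw [mul_one_div_cancel (by linarith)])
    have e : (fun μ : ℝ => McalI (μ + ε * μ) μ) = fun μ : ℝ => McalI ((1 + ε) * μ) μ := by
      funext μ
      congr 1
      ring
    rw [e]
    exact h
  · have h := McalI_aux (1 - ε) 1 (by linarith) (by linarith) le_rfl (by linarith)
    have e : (fun μ : ℝ => McalI (μ - ε * μ) μ) = fun μ : ℝ => McalI ((1 - ε) * μ) μ := by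
      funext μ
      congr 1
      ring
    rw [e]
    exact h
end

section
/- For every ε with 0 < ε < 1 and every μ with 0 < μ < 1/2, one has 𝓜_I(μ + ε·μ, μ) > 𝓜_I(μ − ε·μ, μ). -/
noncomputable def auxG (m z : ℝ) : ℝ :=
  Real.log m - Real.log z + (1 / z - 1) * (Real.log (1 - m) - Real.log (1 - z))

lemma McalI_eq_auxG (z m : ℝ) (h0 : 0 < z) (h1 : z < 1) (hm0 : 0 < m) (hm1 : m < 1) :
    McalI z m = auxG m z := by
  unfold McalI McalB auxG
  rw [Real.log_div hm0.ne' h0.ne', Real.log_div (by linarith) (by linarith)]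
  field_simp

lemma auxG_deriv (z m : ℝ) (h0 : 0 < z) (h1 : z < 1) :
    HasDerivAt (auxG m) (-(Real.log (1 - m) - Real.log (1 - z)) / z ^ 2) z := by
  have hz : z ≠ 0 := h0.ne'
  have hz1 : 1 - z ≠ 0 := by linarith
  have a := (Real.hasDerivAt_log hz).const_sub (Real.log m)
  have b := ((hasDerivAt_inv hz).sub_const 1)
  have c := (((hasDerivAt_id z).const_sub 1).log hz1).const_sub (Real.log (1 - m))
  have d := a.add (b.mul c)
  refine (d.congr_deriv ?_).congr_of_eventuallyEq ?_
  · simp only [id]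
    field_simp
    ring
  · refine Filter.Eventually.of_forall fun x => ?_
    simp [auxG]

theorem McalI_relative_plus_gt_minus (ε μ : ℝ) (hε0 : 0 < ε) (hε1 : ε < 1)
    (hμ0 : 0 < μ) (hμ1 : μ < 1 / 2) :
    McalI (μ + ε * μ) μ > McalI (μ - ε * μ) μ := by
  have key : ∀ x, 0 ≤ x → x < 1 → 0 < μ + x * μ ∧ μ + x * μ < 1 ∧ 0 < μ - x * μ ∧
      μ - x * μ < 1 := by
    intro x hx0 hx1
    refine ⟨by positivity, by nlinarith, by nlinarith, by nlinarith⟩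
  have hd : ∀ x, 0 ≤ x → x < 1 → HasDerivAt
      (fun x => auxG μ (μ + x * μ) - auxG μ (μ - x * μ))
      (-(Real.log (1 - μ) - Real.log (1 - (μ + x * μ))) / (μ + x * μ) ^ 2 * (1 * μ) -
       -(Real.log (1 - μ) - Real.log (1 - (μ - x * μ))) / (μ - x * μ) ^ 2 * (-(1 * μ))) x := by
    intro x hx0 hx1
    obtain ⟨p0, p1, q0, q1⟩ := key x hx0 hx1
    have a := HasDerivAt.comp x (auxG_deriv _ μ p0 p1)
      (((hasDerivAt_id x).mul_const μ).const_add μ)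
    have b := HasDerivAt.comp x (auxG_deriv _ μ q0 q1)
      (((hasDerivAt_id x).mul_const μ).const_sub μ)
    exact a.sub b
  have hmono : StrictMonoOn (fun x => auxG μ (μ + x * μ) - auxG μ (μ - x * μ)) (Set.Ico 0 1) := by
    apply strictMonoOn_of_deriv_pos (convex_Ico 0 1)
    · intro x hx
      exact (hd x hx.1 hx.2).continuousAt.continuousWithinAt
    · intro x hx
      rw [interior_Ico] at hx
      obtain ⟨hx0, hx1⟩ := hx
      rw [(hd x hx0.le hx1).deriv]
      obtain ⟨p0, p1, q0, q1⟩ := key x hx0.le hx1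
      have hxm : 0 < x * μ := by positivity
      have hsum : μ + x * μ + (μ - x * μ) < 1 := by linarith
      have hlt : μ - x * μ < μ + x * μ := by linarith
      have L1 : Real.log (1 - μ) - Real.log (1 - (μ + x * μ)) ≤ x * μ / (1 - (μ + x * μ)) := by
        rw [← Real.log_div (by linarith) (by linarith)]
        refine (Real.log_le_sub_one_of_pos (div_pos (by linarith) (by linarith))).trans_eq ?_
        have : 1 - (μ + x * μ) ≠ 0 := by linarith
        rw [eq_div_iff this, sub_mul, div_mul_cancel₀ _ this]
        ring
      have L2 : Real.log (1 - μ) - Real.log (1 - (μ - x * μ)) ≤ -(x * μ) / (1 - (μ - x * μ)) := by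
        rw [← Real.log_div (by linarith) (by linarith)]
        refine (Real.log_le_sub_one_of_pos (div_pos (by linarith) (by linarith))).trans_eq ?_
        have : 1 - (μ - x * μ) ≠ 0 := by linarith
        rw [eq_div_iff this, sub_mul, div_mul_cancel₀ _ this]
        ring
      generalize Real.log (1 - μ) - Real.log (1 - (μ + x * μ)) = A at *
      generalize Real.log (1 - μ) - Real.log (1 - (μ - x * μ)) = B at *
      generalize μ + x * μ = p at *
      generalize μ - x * μ = q at *
      generalize x * μ = s at *
      have h1 : A / p ^ 2 ≤ s / (1 - p) / p ^ 2 := by gcongr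
      have h2 : B / q ^ 2 ≤ -s / (1 - q) / q ^ 2 := by gcongr
      have h3 : s / (1 - p) / p ^ 2 < s / (1 - q) / q ^ 2 := by
        rw [div_div, div_div]
        have h4 : q * (1 - q) < p * (1 - p) := by nlinarith
        have h5 : 0 < q * (1 - q) := mul_pos q0 (by linarith)
        have h6 : (1 - q) * q ^ 2 < (1 - p) * p ^ 2 := by
          nlinarith [mul_lt_mul'' h4 hlt h5.le q0.le]
        have h7 : 0 < (1 - q) * q ^ 2 := mul_pos (by linarith) (by positivity)
        exact div_lt_div_of_pos_left hxm h7 h6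
      have h8 : -s / (1 - q) / q ^ 2 = -(s / (1 - q) / q ^ 2) := by ring
      have h9 : 0 < (-(A / p ^ 2) - B / q ^ 2) * μ := mul_pos (by linarith) hμ0
      calc 0 < _ := h9
        _ = _ := by ring
  have h := hmono (Set.left_mem_Ico.2 one_pos) ⟨hε0.le, hε1⟩ hε0
  obtain ⟨p0, p1, q0, q1⟩ := key ε hε0.le hε1
  rw [McalI_eq_auxG _ _ p0 p1 hμ0 (by linarith), McalI_eq_auxG _ _ q0 q1 hμ0 (by linarith)]
  simp only [zero_mul, add_zero, sub_zero, sub_self] at h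
  linarith
end

section
/- Let 0 < ε < 1/2. Then the function μ ↦ 𝓜_I(μ + ε, μ) is strictly increasing on the interval (0, 1/2 − ε), and the function μ ↦ 𝓜_I(μ − ε, μ) is strictly increasing on the interval (ε, 1/2 + ε/2). -/
/-- Derivative of `μ ↦ 𝓜_I(μ + e, μ)`. -/
lemma McalI_hasDerivAt (e x : ℝ) (h0 : 0 < x) (h1 : x < 1) (h2 : 0 < x + e) (h3 : x + e < 1) :
    HasDerivAt (fun μ : ℝ => McalI (μ + e) μ)
      (e / ((x + e) * (x * (1 - x))) - Real.log ((1 - x) / (1 - (x + e))) / (x + e) ^ 2) x := by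
  have hx1 : 0 < 1 - x := by linarith
  have hz1 : 0 < 1 - (x + e) := by linarith
  have hz : HasDerivAt (fun μ : ℝ => μ + e) 1 x := (hasDerivAt_id x).add_const e
  have hz' : HasDerivAt (fun μ : ℝ => 1 - (μ + e)) (-1) x := hz.const_sub 1
  have hm' : HasDerivAt (fun μ : ℝ => 1 - μ) (-1) x := (hasDerivAt_id x).const_sub 1
  have l1 := ((hasDerivAt_id x).div hz h2.ne').log (div_pos h0 h2).ne'
  have l2 := (hm'.div hz' hz1.ne').log (div_pos hx1 hz1).ne'
  have key := ((hz.mul l1).add (hz'.mul l2)).div hz h2.ne'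
  refine HasDerivAt.congr_deriv (f := fun μ : ℝ => McalI (μ + e) μ) key ?_
  simp only [Pi.mul_apply, Pi.add_apply, Pi.div_apply, id]
  generalize Real.log ((1 - x) / (1 - (x + e))) = L
  generalize Real.log (x / (x + e)) = K
  have a1 := h0.ne'
  have a2 := h2.ne'
  have a3 := hx1.ne'
  have a4 := hz1.ne'
  field_simp
  ring

lemma McalI_deriv_pos (e x : ℝ) (he : e ≠ 0) (h0 : 0 < x) (h1 : x < 1) (h2 : 0 < x + e)
    (h3 : x + e < 1) (h4 : 2 * x + e < 1) :
    0 < e / ((x + e) * (x * (1 - x))) - Real.log ((1 - x) / (1 - (x + e))) / (x + e) ^ 2 := by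
  have hx1 : 0 < 1 - x := by linarith
  have hz1 : 0 < 1 - (x + e) := by linarith
  have hL : Real.log ((1 - x) / (1 - (x + e))) < (1 - x) / (1 - (x + e)) - 1 := by
    apply Real.log_lt_sub_one_of_pos (div_pos hx1 hz1)
    intro h
    rw [div_eq_one_iff_eq hz1.ne'] at h
    apply he
    linarith
  have hd : 0 ≤ e / ((x + e) * (x * (1 - x))) - ((1 - x) / (1 - (x + e)) - 1) / (x + e) ^ 2 := by
    have : e / ((x + e) * (x * (1 - x))) - ((1 - x) / (1 - (x + e)) - 1) / (x + e) ^ 2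
        = e ^ 2 * (1 - (2 * x + e)) / ((x + e) ^ 2 * (x * (1 - x)) * (1 - (x + e))) := by
      have a1 := h0.ne'
      have a2 := h2.ne'
      have a3 := hx1.ne'
      have a4 := hz1.ne'
      field_simp
      ring
    rw [this]
    have : 0 < 1 - (2 * x + e) := by linarith
    positivity
  have : Real.log ((1 - x) / (1 - (x + e))) / (x + e) ^ 2
      < ((1 - x) / (1 - (x + e)) - 1) / (x + e) ^ 2 :=
    div_lt_div_of_pos_right hL (by positivity)
  linarith

lemma McalI_strictMonoOn_aux (e a b : ℝ) (he : e ≠ 0)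
    (h : ∀ x ∈ Set.Ioo a b, 0 < x ∧ x < 1 ∧ 0 < x + e ∧ x + e < 1 ∧ 2 * x + e < 1) :
    StrictMonoOn (fun μ : ℝ => McalI (μ + e) μ) (Set.Ioo a b) := by
  apply strictMonoOn_of_deriv_pos (convex_Ioo a b)
  · intro x hx
    obtain ⟨h0, h1, h2, h3, -⟩ := h x hx
    exact (McalI_hasDerivAt e x h0 h1 h2 h3).continuousAt.continuousWithinAt
  · intro x hx
    rw [interior_Ioo] at hx
    obtain ⟨h0, h1, h2, h3, h4⟩ := h x hx
    rw [(McalI_hasDerivAt e x h0 h1 h2 h3).deriv]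
    exact McalI_deriv_pos e x he h0 h1 h2 h3 h4

theorem McalI_absolute_strictMono (ε : ℝ) (hε0 : 0 < ε) (hε1 : ε < 1 / 2) :
    StrictMonoOn (fun μ : ℝ => McalI (μ + ε) μ) (Set.Ioo 0 (1 / 2 - ε)) ∧
    StrictMonoOn (fun μ : ℝ => McalI (μ - ε) μ) (Set.Ioo ε (1 / 2 + ε / 2)) := by
  constructor
  · apply McalI_strictMonoOn_aux ε _ _ hε0.ne'
    rintro x ⟨h1, h2⟩
    refine ⟨?_, ?_, ?_, ?_, ?_⟩ <;> linarith
  · have := McalI_strictMonoOn_aux (-ε) ε (1 / 2 + ε / 2) (neg_ne_zero.mpr hε0.ne') (by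
      rintro x ⟨h1, h2⟩
      refine ⟨?_, ?_, ?_, ?_, ?_⟩ <;> linarith)
    simpa only [← sub_eq_add_neg] using this
end

section
/- For all ε, μ with 0 < ε < μ < 1/2, one has 𝓜_I(μ + ε, μ) > 𝓜_I(μ − ε, μ). -/
theorem McalI_hasDerivAt_s15 (z μ : ℝ) (hz : 0 < z) (hz1 : z < 1) (hm : 0 < μ) (hm1 : μ < 1) :
    HasDerivAt (fun z => McalI z μ) ((Real.log (1 - z) - Real.log (1 - μ)) / z ^ 2) z := by
  have h1z : (0 : ℝ) < 1 - z := by linarith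
  have h1m : (0 : ℝ) < 1 - μ := by linarith
  have key : HasDerivAt (fun z : ℝ => (Real.log μ - Real.log z)
      + (z⁻¹ - 1) * (Real.log (1 - μ) - Real.log (1 - z)))
      ((Real.log (1 - z) - Real.log (1 - μ)) / z ^ 2) z := by
    have a := (Real.hasDerivAt_log hz.ne').const_sub (Real.log μ)
    have b := (hasDerivAt_inv hz.ne').sub_const 1
    have c := (((hasDerivAt_id z).const_sub 1).log h1z.ne').const_sub (Real.log (1 - μ))
    have d := a.add (b.mul c)
    refine d.congr_deriv ?_
    simp only [id]
    field_simp
    ring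
  refine key.congr_of_eventuallyEq ?_
  filter_upwards [Ioo_mem_nhds hz hz1] with w hw
  have hw1 : (0 : ℝ) < 1 - w := by linarith [hw.2]
  have hw0 := hw.1
  unfold McalI McalB
  rw [Real.log_div hm.ne' hw0.ne', Real.log_div h1m.ne' hw1.ne']
  field_simp

theorem McalI_aux_s15 (t μ : ℝ) (h0 : 0 < t) (h1 : t < μ) (hμ : μ < 1 / 2) :
    0 < (Real.log (1 - (μ + t)) - Real.log (1 - μ)) / (μ + t) ^ 2
      + (Real.log (1 - (μ - t)) - Real.log (1 - μ)) / (μ - t) ^ 2 := by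
  have hm : (0 : ℝ) < 1 - μ := by linarith
  have hp : (0 : ℝ) < 1 - (μ + t) := by linarith
  have hq : (0 : ℝ) < 1 - (μ - t) := by linarith
  have e1 := Real.one_sub_inv_le_log_of_pos (div_pos hp hm)
  have e2 := Real.one_sub_inv_le_log_of_pos (div_pos hq hm)
  rw [Real.log_div hp.ne' hm.ne'] at e1
  rw [Real.log_div hq.ne' hm.ne'] at e2
  have hs : 0 < μ + t := by linarith
  have hd : 0 < μ - t := by linarith
  have f1 : 1 - ((1 - (μ + t)) / (1 - μ))⁻¹ = -(t / (1 - (μ + t))) := by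
    field_simp
    ring
  have f2 : 1 - ((1 - (μ - t)) / (1 - μ))⁻¹ = t / (1 - (μ - t)) := by
    field_simp
    ring
  rw [f1] at e1
  rw [f2] at e2
  have g1 := div_le_div_of_nonneg_right e1 (sq_nonneg (μ + t))
  have g2 := div_le_div_of_nonneg_right e2 (sq_nonneg (μ - t))
  refine lt_of_lt_of_le ?_ (add_le_add g1 g2)
  have : -(t / (1 - (μ + t))) / (μ + t) ^ 2 + t / (1 - (μ - t)) / (μ - t) ^ 2
      = 2 * t ^ 2 * (2 * μ - 3 * μ ^ 2 - t ^ 2)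
        / ((1 - (μ + t)) * (μ + t) ^ 2 * (1 - (μ - t)) * (μ - t) ^ 2) := by
    field_simp
    ring
  rw [this]
  have : 0 < 2 * μ - 3 * μ ^ 2 - t ^ 2 := by nlinarith
  positivity

theorem McalI_absolute_plus_gt_minus (ε μ : ℝ) (hε0 : 0 < ε) (hεμ : ε < μ)
    (hμ : μ < 1 / 2) :
    McalI (μ + ε) μ > McalI (μ - ε) μ := by
  have hd : ∀ t ∈ Set.Icc 0 ε, HasDerivAt (fun t => McalI (μ + t) μ - McalI (μ - t) μ)
      ((Real.log (1 - (μ + t)) - Real.log (1 - μ)) / (μ + t) ^ 2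
      + (Real.log (1 - (μ - t)) - Real.log (1 - μ)) / (μ - t) ^ 2) t := by
    rintro t ⟨h0, h1⟩
    have a := (McalI_hasDerivAt_s15 (μ + t) μ (by linarith) (by linarith) (by linarith)
      (by linarith)).comp t ((hasDerivAt_id t).const_add μ)
    have b := (McalI_hasDerivAt_s15 (μ - t) μ (by linarith) (by linarith) (by linarith)
      (by linarith)).comp t ((hasDerivAt_id t).const_sub μ)
    refine (a.sub b).congr_deriv ?_
    ring
  have hmono : StrictMonoOn (fun t => McalI (μ + t) μ - McalI (μ - t) μ) (Set.Icc 0 ε) := by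
    refine strictMonoOn_of_deriv_pos (convex_Icc 0 ε)
      (fun t ht => (hd t ht).continuousAt.continuousWithinAt) ?_
    intro t ht
    rw [interior_Icc] at ht
    rw [(hd t ⟨ht.1.le, ht.2.le⟩).deriv]
    exact McalI_aux_s15 t μ ht.1 (ht.2.trans hεμ) hμ
  have := hmono ⟨le_rfl, hε0.le⟩ ⟨hε0.le, le_rfl⟩ hε0
  simp only [add_zero, sub_zero, sub_self] at this
  linarith
end

section
/- Let 0 < ε < 1/2. Then the function μ ↦ 𝓜_B(μ + ε, μ) is strictly increasing on the interval (0, 1/2 − ε), and the function μ ↦ 𝓜_B(μ − ε, μ) is strictly increasing on the interval (ε, 1/2). -/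
lemma logit_hasDeriv (t : ℝ) (h0 : 0 < t) (h1 : t < 1 / 2) :
    HasDerivAt (fun t : ℝ => Real.log t - Real.log (1 - t)) (1 / (t * (1 - t))) t := by
  have h := (Real.hasDerivAt_log h0.ne').sub
    (((hasDerivAt_id t).const_sub 1).log (by simp only [id]; linarith))
  have h2 : (1 - t) ≠ 0 := by linarith
  refine HasDerivAt.congr_deriv (f := fun t : ℝ => Real.log t - Real.log (1 - t)) h ?_
  simp only [id]
  field_simp
  ring

lemma logit_tangent (z m : ℝ) (hz0 : 0 < z) (hz1 : z < 1 / 2) (hm0 : 0 < m) (hm1 : m < 1 / 2)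
    (hne : z ≠ m) :
    (Real.log z - Real.log (1 - z)) - (Real.log m - Real.log (1 - m))
      < (z - m) * (1 / (m * (1 - m))) := by
  rcases lt_or_gt_of_ne hne with h | h
  · obtain ⟨x, hx, he⟩ := exists_hasDerivAt_eq_slope
      (fun t : ℝ => Real.log t - Real.log (1 - t)) (fun t => 1 / (t * (1 - t))) h
      (fun t ht => (logit_hasDeriv t (by linarith [ht.1])
        (by linarith [ht.2])).continuousAt.continuousWithinAt)
      (fun t ht => logit_hasDeriv t (by linarith [ht.1]) (by linarith [ht.2]))
    obtain ⟨hx1, hx2⟩ := hx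
    have hlt : 1 / (m * (1 - m)) < 1 / (x * (1 - x)) := by
      apply one_div_lt_one_div_of_lt
      · exact mul_pos (by linarith) (by linarith)
      · nlinarith
    rw [eq_div_iff (by linarith)] at he
    nlinarith
  · obtain ⟨x, hx, he⟩ := exists_hasDerivAt_eq_slope
      (fun t : ℝ => Real.log t - Real.log (1 - t)) (fun t => 1 / (t * (1 - t))) h
      (fun t ht => (logit_hasDeriv t (by linarith [ht.1])
        (by linarith [ht.2])).continuousAt.continuousWithinAt)
      (fun t ht => logit_hasDeriv t (by linarith [ht.1]) (by linarith [ht.2]))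
    obtain ⟨hx1, hx2⟩ := hx
    have hlt : 1 / (x * (1 - x)) < 1 / (m * (1 - m)) := by
      apply one_div_lt_one_div_of_lt
      · exact mul_pos (by linarith) (by linarith)
      · nlinarith
    rw [eq_div_iff (by linarith)] at he
    nlinarith

lemma McalB_hasDeriv (c m : ℝ) (hm0 : 0 < m) (hm1 : m < 1 / 2) (hz0 : 0 < m + c)
    (hz1 : m + c < 1 / 2) :
    HasDerivAt (fun μ : ℝ => McalB (μ + c) μ)
      ((m + c - m) * (1 / (m * (1 - m))) - ((Real.log (m + c) - Real.log (1 - (m + c)))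
        - (Real.log m - Real.log (1 - m)))) m := by
  have h1m : (1 - m) ≠ 0 := by linarith
  have h1z : (1 - (m + c)) ≠ 0 := by linarith
  have hz : HasDerivAt (fun μ : ℝ => μ + c) 1 m := (hasDerivAt_id m).add_const c
  have hw : HasDerivAt (fun μ : ℝ => 1 - (μ + c)) (-1) m := hz.const_sub 1
  have hv : HasDerivAt (fun μ : ℝ => 1 - μ) (-1) m := (hasDerivAt_id m).const_sub 1
  have h := (hz.mul (((hasDerivAt_id m).div hz hz0.ne').log
      (div_ne_zero hm0.ne' hz0.ne'))).add
    (hw.mul ((hv.div hw h1z).log (div_ne_zero h1m h1z)))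
  refine HasDerivAt.congr_deriv (f := fun μ : ℝ => McalB (μ + c) μ) h ?_
  simp only [id, Pi.div_apply]
  rw [Real.log_div hm0.ne' hz0.ne', Real.log_div h1m h1z]
  have hz0' := hz0.ne'
  generalize Real.log (m + c) = A
  generalize Real.log (1 - (m + c)) = B
  generalize Real.log m = C
  generalize Real.log (1 - m) = D
  field_simp
  ring

lemma McalB_mono_aux (c a b : ℝ) (hc : c ≠ 0)
    (H : ∀ m ∈ Set.Ioo a b, 0 < m ∧ m < 1 / 2 ∧ 0 < m + c ∧ m + c < 1 / 2) :
    StrictMonoOn (fun μ : ℝ => McalB (μ + c) μ) (Set.Ioo a b) := by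
  apply strictMonoOn_of_deriv_pos (convex_Ioo a b)
  · intro m hm
    obtain ⟨h1, h2, h3, h4⟩ := H m hm
    exact (McalB_hasDeriv c m h1 h2 h3 h4).continuousAt.continuousWithinAt
  · intro m hm
    rw [interior_Ioo] at hm
    obtain ⟨h1, h2, h3, h4⟩ := H m hm
    rw [(McalB_hasDeriv c m h1 h2 h3 h4).deriv]
    have := logit_tangent (m + c) m h3 h4 h1 h2 (by simpa using hc)
    linarith

theorem McalB_absolute_strictMono (ε : ℝ) (hε0 : 0 < ε) (hε1 : ε < 1 / 2) :
    StrictMonoOn (fun μ : ℝ => McalB (μ + ε) μ) (Set.Ioo 0 (1 / 2 - ε)) ∧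
    StrictMonoOn (fun μ : ℝ => McalB (μ - ε) μ) (Set.Ioo ε (1 / 2)) := by
  constructor
  · apply McalB_mono_aux ε _ _ hε0.ne'
    rintro m ⟨h1, h2⟩
    refine ⟨?_, ?_, ?_, ?_⟩ <;> linarith
  · simp only [sub_eq_add_neg]
    apply McalB_mono_aux (-ε) _ _ (neg_ne_zero.mpr hε0.ne')
    rintro m ⟨h1, h2⟩
    refine ⟨?_, ?_, ?_, ?_⟩ <;> linarith
end

section
/- Let 0 < ε < 1/2. Then for every μ with ε < μ < 1/2, one has 𝓜_B(μ + ε, μ) > 𝓜_B(μ − ε, μ). -/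
lemma aux_hasDeriv (a t : ℝ) (c : ℝ) (h : 0 < a + c * t) :
    HasDerivAt (fun t : ℝ => (a + c * t) * (Real.log a - Real.log (a + c * t)))
      (c * (Real.log a - Real.log (a + c * t)) - c) t := by
  have h1 : HasDerivAt (fun t : ℝ => a + c * t) c t := by
    simpa using ((hasDerivAt_id t).const_mul c).const_add a
  have h2 := h1.mul ((h1.log h.ne').const_sub (Real.log a))
  refine h2.congr_deriv ?_
  field_simp
  ring

lemma aux_log (a b t : ℝ) (ht : 0 < t) (hta : t < a) (hab : a < b) :
    2 * Real.log b + (Real.log (a + t) + Real.log (a - t)) <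
      2 * Real.log a + (Real.log (b + t) + Real.log (b - t)) := by
  have e : ∀ x y : ℝ, 0 < x → t < y → t < x →
      2 * Real.log x + (Real.log (y + t) + Real.log (y - t))
        = Real.log (x ^ 2 * ((y + t) * (y - t))) := by
    intro x y hx hy _
    rw [Real.log_mul (by positivity) (mul_pos (by linarith) (by linarith)).ne',
      Real.log_mul (by linarith) (by linarith), Real.log_pow]
    norm_num
  rw [e b a (by linarith) hta (by linarith), e a b (by linarith) (by linarith) hta]
  apply Real.log_lt_log
  · have : 0 < (a + t) * (a - t) := mul_pos (by linarith) (by linarith)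
    have : 0 < b := by linarith
    positivity
  · have h1 : 0 < (b - a) * (b + a) := mul_pos (by linarith) (by linarith)
    have h2 := mul_pos h1 (pow_pos ht 2)
    nlinarith [h2]

theorem McalB_absolute_plus_gt_minus (ε : ℝ) (hε0 : 0 < ε) (hε1 : ε < 1 / 2) :
    ∀ μ : ℝ, ε < μ → μ < 1 / 2 → McalB (μ + ε) μ > McalB (μ - ε) μ := by
  intro μ h1 h2
  let g : ℝ → ℝ → ℝ → ℝ := fun a c t => (a + c * t) * (Real.log a - Real.log (a + c * t))
  let D : ℝ → ℝ := fun t => (g μ 1 t + g (1 - μ) (-1) t) - (g μ (-1) t + g (1 - μ) 1 t)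
  have hd : ∀ t ∈ Set.Icc 0 ε, HasDerivAt D _ t := fun t ht =>
    ((aux_hasDeriv μ t 1 (by linarith [ht.1, ht.2])).add
      (aux_hasDeriv (1 - μ) t (-1) (by linarith [ht.1, ht.2]))).sub
    ((aux_hasDeriv μ t (-1) (by linarith [ht.1, ht.2])).add
      (aux_hasDeriv (1 - μ) t 1 (by linarith [ht.1, ht.2])))
  have hm : StrictMonoOn D (Set.Icc 0 ε) := by
    apply strictMonoOn_of_deriv_pos (convex_Icc 0 ε)
    · exact fun t ht => (hd t ht).continuousAt.continuousWithinAt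
    · intro t ht
      rw [interior_Icc] at ht
      rw [(hd t ⟨ht.1.le, ht.2.le⟩).deriv]
      have := aux_log μ (1 - μ) t ht.1 (by linarith [ht.2]) (by linarith)
      simp only [one_mul, neg_mul, ← sub_eq_add_neg]
      linarith
  have h := hm (Set.left_mem_Icc.2 hε0.le) (Set.right_mem_Icc.2 hε0.le) hε0
  simp only [D, g, mul_zero, add_zero, sub_zero, sub_self, one_mul, neg_mul, ← sub_eq_add_neg] at h
  unfold McalB
  rw [Real.log_div (by linarith) (by linarith), Real.log_div (by linarith) (by linarith),
    Real.log_div (by linarith) (by linarith), Real.log_div (by linarith) (by linarith),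
    show 1 - (μ + ε) = 1 - μ - ε by ring, show 1 - (μ - ε) = 1 - μ + ε by ring]
  linarith
end

section
/- Let 0 < ε < 1. Then the function μ ↦ 𝓜_B(μ + ε·μ, μ) is strictly decreasing on the interval (0, 1/(1+ε)), the function μ ↦ 𝓜_B(μ − ε·μ, μ) is strictly decreasing on the interval (0, 1), and moreover 𝓜_B(μ + ε·μ, μ) > 𝓜_B(μ − ε·μ, μ) for every μ ∈ (0, 1/2). -/
lemma McalB_hasDerivAt {z m : ℝ → ℝ} {z' m' x : ℝ} (hz : HasDerivAt z z' x)
    (hm : HasDerivAt m m' x) (z0 : 0 < z x) (z1 : z x < 1) (m0 : 0 < m x) (m1 : m x < 1) :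
    HasDerivAt (fun y => McalB (z y) (m y))
      (z' * (Real.log (m x) - Real.log (z x) - Real.log (1 - m x) + Real.log (1 - z x))
        + m' * (z x / m x - (1 - z x) / (1 - m x))) x := by
  have z2 : 0 < 1 - z x := by linarith
  have m2 : 0 < 1 - m x := by linarith
  have hz2 : HasDerivAt (fun y => 1 - z y) (-z') x := hz.const_sub 1
  have hm2 : HasDerivAt (fun y => 1 - m y) (-m') x := hm.const_sub 1
  have h1 := hz.mul ((hm.div hz z0.ne').log (div_pos m0 z0).ne')
  have h2 := hz2.mul ((hm2.div hz2 z2.ne').log (div_pos m2 z2).ne')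
  refine (h1.add h2).congr_deriv ?_
  simp only [Pi.div_apply]
  rw [Real.log_div m0.ne' z0.ne', Real.log_div m2.ne' z2.ne']
  field_simp
  ring

lemma McalB_scale_anti (a b : ℝ) (ha : 0 < a) (ha1 : a ≠ 1) (hb : b ≤ 1) (hab : a * b ≤ 1) :
    StrictAntiOn (fun μ : ℝ => McalB (a * μ) μ) (Set.Ioo 0 b) := by
  have key : ∀ x ∈ Set.Ioo 0 b, ∃ d < 0, HasDerivAt (fun μ : ℝ => McalB (a * μ) μ) d x := by
    rintro x ⟨x0, xb⟩
    have hax : a * x < 1 := lt_of_lt_of_le (mul_lt_mul_of_pos_left xb ha) hab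
    have hax0 : 0 < a * x := mul_pos ha x0
    have x1 : x < 1 := by linarith
    have p1 : 0 < 1 - x := by linarith
    have p2 : 0 < 1 - a * x := by linarith
    have hz : HasDerivAt (fun y : ℝ => a * y) a x := by
      simpa using (hasDerivAt_id x).const_mul a
    refine ⟨_, ?_, McalB_hasDerivAt hz (hasDerivAt_id' x) hax0 hax x0 x1⟩
    have ht : 0 < (1 - a * x) / (a * (1 - x)) := by positivity
    have hne : (1 - a * x) / (a * (1 - x)) ≠ 1 := by
      intro h
      rw [div_eq_one_iff_eq (by positivity)] at h
      apply ha1; linarith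
    have hl := Real.log_lt_sub_one_of_pos ht hne
    rw [Real.log_div p2.ne' (by positivity), Real.log_mul ha.ne' p1.ne'] at hl
    have hl2 := mul_lt_mul_of_pos_left hl ha
    have e1 : a * ((1 - a * x) / (a * (1 - x)) - 1) = (1 - a * x) / (1 - x) - a := by
      field_simp
    have e2 : a * x / x = a := by field_simp
    rw [e1] at hl2
    simp only [Real.log_mul ha.ne' x0.ne', e2]
    linarith
  apply strictAntiOn_of_deriv_neg (convex_Ioo 0 b)
  · intro x hx
    obtain ⟨d, _, h⟩ := key x hx
    exact h.continuousAt.continuousWithinAt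
  · intro x hx
    rw [interior_Ioo] at hx
    obtain ⟨d, hd, h⟩ := key x hx
    rwa [h.deriv]

lemma McalB_plus_gt (ε : ℝ) (hε0 : 0 < ε) (hε1 : ε < 1) (μ : ℝ) (h0 : 0 < μ) (h1 : μ < 1 / 2) :
    McalB (μ + ε * μ) μ > McalB (μ - ε * μ) μ := by
  have key : ∀ e ∈ Set.Ico (0:ℝ) 1, ∃ d, (0 < e → 0 < d) ∧
      HasDerivAt (fun e : ℝ => McalB (μ + e * μ) μ - McalB (μ - e * μ) μ) d e := by
    rintro e ⟨e0, e1⟩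
    have b1 : 0 ≤ e * μ := by positivity
    have b2 : e * μ < μ := by nlinarith
    have hd : HasDerivAt (fun y : ℝ => y * μ) μ e := by
      simpa using (hasDerivAt_id e).mul_const μ
    have hp := McalB_hasDerivAt (hd.const_add μ) (hasDerivAt_const e μ)
      (by linarith) (by linarith) h0 (by linarith)
    have hm := McalB_hasDerivAt (hd.const_sub μ) (hasDerivAt_const e μ)
      (by linarith) (by linarith) h0 (by linarith)
    refine ⟨_, ?_, hp.sub hm⟩
    intro epos
    have q1 : 0 < 1 - μ := by linarith
    have q2 : 0 < μ + e * μ := by linarith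
    have q3 : 0 < μ - e * μ := by linarith
    have q4 : 0 < 1 - (μ + e * μ) := by linarith
    have q5 : 0 < 1 - (μ - e * μ) := by linarith
    have hlt : ((μ + e * μ) * (μ - e * μ)) * ((1 - μ) * (1 - μ))
        < (μ * μ) * ((1 - (μ + e * μ)) * (1 - (μ - e * μ))) := by
      have : 0 < μ ^ 2 * e ^ 2 * (1 - 2 * μ) := by
        have : 0 < 1 - 2 * μ := by linarith
        positivity
      nlinarith
    have hl := Real.log_lt_log (by positivity) hlt
    rw [Real.log_mul (by positivity) (by positivity), Real.log_mul (by positivity) (by positivity),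
      Real.log_mul (by positivity) (by positivity), Real.log_mul (by positivity) (by positivity),
      Real.log_mul (by positivity) (by positivity), Real.log_mul (by positivity) (by positivity)]
      at hl
    have := mul_lt_mul_of_pos_left hl h0
    linarith
  have hmono : StrictMonoOn (fun e : ℝ => McalB (μ + e * μ) μ - McalB (μ - e * μ) μ)
      (Set.Ico 0 1) := by
    apply strictMonoOn_of_deriv_pos (convex_Ico 0 1)
    · intro x hx
      obtain ⟨d, _, h⟩ := key x hx
      exact h.continuousAt.continuousWithinAt
    · intro x hx
      rw [interior_Ico] at hx
      obtain ⟨d, hd, h⟩ := key x ⟨hx.1.le, hx.2⟩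
      rw [h.deriv]
      exact hd hx.1
  have := hmono (⟨le_rfl, one_pos⟩ : (0:ℝ) ∈ Set.Ico (0:ℝ) 1) ⟨hε0.le, hε1⟩ hε0
  simp only [zero_mul, add_zero, sub_zero, sub_self] at this
  linarith

theorem McalB_relative_strictAnti_and_plus_gt_minus (ε : ℝ) (hε0 : 0 < ε) (hε1 : ε < 1) :
    StrictAntiOn (fun μ : ℝ => McalB (μ + ε * μ) μ) (Set.Ioo 0 (1 / (1 + ε))) ∧
    StrictAntiOn (fun μ : ℝ => McalB (μ - ε * μ) μ) (Set.Ioo 0 1) ∧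
    ∀ μ ∈ Set.Ioo (0 : ℝ) (1 / 2), McalB (μ + ε * μ) μ > McalB (μ - ε * μ) μ := by
  refine ⟨?_, ?_, fun μ hμ => McalB_plus_gt ε hε0 hε1 μ hμ.1 hμ.2⟩
  · have h := McalB_scale_anti (1 + ε) (1 / (1 + ε)) (by linarith) (by linarith)
      (by rw [div_le_one (by linarith)]; linarith)
      (by rw [mul_one_div_cancel (by linarith)])
    simpa only [add_mul, one_mul] using h
  · have h := McalB_scale_anti (1 - ε) 1 (by linarith) (by linarith) le_rfl (by linarith)
    simpa only [sub_mul, one_mul] using h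
end

section
/- Let 0 < ε_r < 1, let γ > (1 − ε_r)/ε_r, and set ε′ = 1 − γ·(1 − ε_r)/(γ + ε_r − 1). Then for every μ ∈ (0, 1), writing z = (1 − ε_r)·μ, one has 𝓜_I( z·γ/(γ − z), μ ) < 𝓜_I( (1 − ε′)·μ, μ ). -/
theorem McalI_lt_aux (a b μ : ℝ) (ha : 0 < a) (hab : a < b) (hb : b < μ) (hμ : μ < 1) :
    McalI a μ < McalI b μ := by
  have hb0 : 0 < b := ha.trans hab
  have hm0 : 0 < μ := hb0.trans hb
  have h1 : 0 < 1 - μ := by linarith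
  have h2 : 0 < 1 - b := by linarith
  have h3 : 0 < 1 - a := by linarith
  unfold McalI McalB
  rw [Real.log_div hm0.ne' ha.ne', Real.log_div hm0.ne' hb0.ne', Real.log_div h1.ne' h3.ne',
    Real.log_div h1.ne' h2.ne', div_lt_div_iff₀ ha hb0]
  have k1 : Real.log (1 - μ) < Real.log (1 - b) := Real.log_lt_log h1 (by linarith)
  have e1 : a * (Real.log b - Real.log a) ≤ b - a := by
    rw [← Real.log_div hb0.ne' ha.ne']
    have := mul_le_mul_of_nonneg_left (Real.log_le_sub_one_of_pos (div_pos hb0 ha)) ha.le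
    have e : a * (b / a - 1) = b - a := by field_simp
    linarith
  have e2 : (1 - a) * (Real.log (1 - b) - Real.log (1 - a)) ≤ a - b := by
    rw [← Real.log_div h2.ne' h3.ne']
    have := mul_le_mul_of_nonneg_left (Real.log_le_sub_one_of_pos (div_pos h2 h3)) h3.le
    have e : (1 - a) * ((1 - b) / (1 - a) - 1) = a - b := by field_simp; ring
    linarith
  have e3 := mul_le_mul_of_nonneg_left (add_le_add e1 e2) hb0.le
  have e4 := mul_lt_mul_of_pos_left k1 (sub_pos.2 hab)
  nlinarith [e3, e4]

theorem McalI_truncation_comparison (εr γ : ℝ) (hεr0 : 0 < εr) (hεr1 : εr < 1)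
    (hγ : γ > (1 - εr) / εr) :
    ∀ μ ∈ Set.Ioo (0 : ℝ) 1,
      McalI ((1 - εr) * μ * γ / (γ - (1 - εr) * μ)) μ
        < McalI ((1 - (1 - γ * (1 - εr) / (γ + εr - 1))) * μ) μ := by
  intro μ hμ
  obtain ⟨hm0, hm1⟩ := hμ
  have hc : 0 < 1 - εr := by linarith
  have hg : 1 - εr < γ * εr := (div_lt_iff₀ hεr0).1 hγ
  have hg0 : 0 < γ := (div_pos hc hεr0).trans hγ
  have hd : 0 < γ + εr - 1 := by nlinarith
  have hcm : (1 - εr) * μ < 1 - εr := by nlinarith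
  have hd' : 0 < γ - (1 - εr) * μ := by linarith
  have hn : 0 < (1 - εr) * μ * γ := by positivity
  have hb : (1 - (1 - γ * (1 - εr) / (γ + εr - 1))) * μ
      = (1 - εr) * μ * γ / (γ + εr - 1) := by ring
  rw [hb]
  refine McalI_lt_aux _ _ _ (div_pos hn hd') ?_ ?_ hm1
  · exact div_lt_div_of_pos_left hn hd (by linarith)
  · rw [div_lt_iff₀ hd]
    nlinarith
end
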